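/- Fix ε > 0 and k ∈ ℕ. For every measurable f : ℝ^d × ℝ^d → ℂ with ‖f‖_{X₀} < ∞ and every η ∈ ℝ, the function D^k_{ε,η} f given by (D^k_{ε,η} f)(x,v) := ∫₀^{t₋(x,v)} t^k e^{−(ε+iη)t} f(x − t·v, v) dt belongs to X₀, and ‖D^k_{ε,η} f‖_{X₀} → 0 as |η| → ∞. (In other words, every η-derivative of order k of the resolvent η ↦ R(ε+iη, T₀)f of the free transport operator vanishes in X₀ at infinity.) -/

import Mathlib

open MeasureTheory Set Filter
open scoped ENNReal NNReal Topology

/-- The backward exit time `t₋(x,v) = inf {s > 0 : x - s • v ∉ Ω}` (with `inf ∅ = ∞`),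
valued in `ℝ≥0∞`. -/
noncomputable def tminus {d : ℕ} (Ω : Set (EuclideanSpace ℝ (Fin d)))
    (x v : EuclideanSpace ℝ (Fin d)) : ℝ≥0∞ :=
  ⨅ (s : ℝ) (_ : 0 < s ∧ x - s • v ∉ Ω), ENNReal.ofReal s

/-- The norm `‖f‖_{X_s} = ∫_{Ω×ℝ^d} max(1,|v|^{-s}) |f(x,v)| dx m(dv)`. -/
noncomputable def Xnorm {d : ℕ} (Ω : Set (EuclideanSpace ℝ (Fin d)))
    (m : Measure (EuclideanSpace ℝ (Fin d))) (s : ℕ)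
    (f : EuclideanSpace ℝ (Fin d) → EuclideanSpace ℝ (Fin d) → ℂ) : ℝ≥0∞ :=
  ∫⁻ x in Ω, ∫⁻ v, ENNReal.ofReal (max 1 (‖v‖⁻¹ ^ s)) * (‖f x v‖₊ : ℝ≥0∞) ∂m

/-- The `k`-th derivative kernel of the resolvent of the free transport operator:
`(D^k_{ε,η} f)(x,v) = ∫₀^{t₋(x,v)} t^k e^{-(ε+iη)t} f(x - t v, v) dt`; for `k = 0` this is
the resolvent `R(ε+iη, T₀)f` with absorbing boundary conditions. -/
noncomputable def resKer {d : ℕ} (Ω : Set (EuclideanSpace ℝ (Fin d))) (k : ℕ) (ε η : ℝ)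
    (f : EuclideanSpace ℝ (Fin d) → EuclideanSpace ℝ (Fin d) → ℂ)
    (x v : EuclideanSpace ℝ (Fin d)) : ℂ :=
  ∫ t in {t : ℝ | 0 < t ∧ ENNReal.ofReal t < tminus Ω x v},
    (t : ℂ) ^ k * Complex.exp (-((ε : ℂ) + (η : ℂ) * Complex.I) * (t : ℂ)) * f (x - t • v) v

section Helpers

variable {d : ℕ}

/-- The times `t > 0` for which the whole backward segment from `x` to `x - t • v` stays in `Ω`,
as a subset of phase space times time. -/
def staySet (Ω : Set (EuclideanSpace ℝ (Fin d))) :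
    Set ((EuclideanSpace ℝ (Fin d) × EuclideanSpace ℝ (Fin d)) × ℝ) :=
  {q | 0 < q.2 ∧ ∀ θ ∈ Icc (0 : ℝ) 1, q.1.1 - (θ * q.2) • q.1.2 ∈ Ω}

theorem isOpen_staySet {Ω : Set (EuclideanSpace ℝ (Fin d))} (hΩ : IsOpen Ω) :
    IsOpen (staySet Ω) := by
  refine (isOpen_lt continuous_const continuous_snd).inter (isOpen_iff_mem_nhds.2 fun q hq => ?_)
  refine isCompact_Icc.eventually_forall_of_forall_eventually fun θ hθ => ?_
  have hc : Continuous fun z : ((EuclideanSpace ℝ (Fin d) × EuclideanSpace ℝ (Fin d)) × ℝ) × ℝ =>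
      z.1.1.1 - (z.2 * z.1.2) • z.1.1.2 := by fun_prop
  exact (hΩ.preimage hc).mem_nhds (hq θ hθ)

theorem sub_smul_mem_of_lt_tminus {Ω : Set (EuclideanSpace ℝ (Fin d))}
    {x v : EuclideanSpace ℝ (Fin d)} {t : ℝ} (ht : 0 < t)
    (h : ENNReal.ofReal t < tminus Ω x v) : x - t • v ∈ Ω := by
  by_contra hn
  exact absurd h (not_lt.2 (iInf₂_le t ⟨ht, hn⟩))

theorem lt_tminus_iff_mem_staySet {Ω : Set (EuclideanSpace ℝ (Fin d))} (hΩ : IsOpen Ω)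
    {x v : EuclideanSpace ℝ (Fin d)} (hx : x ∈ Ω) (t : ℝ) :
    (0 < t ∧ ENNReal.ofReal t < tminus Ω x v) ↔ ((x, v), t) ∈ staySet Ω := by
  refine and_congr_right fun ht => ⟨fun h θ hθ => ?_, fun h => ?_⟩
  · rcases hθ.1.eq_or_lt with h0 | h0
    · simpa [← h0] using hx
    · refine sub_smul_mem_of_lt_tminus (mul_pos h0 ht) (lt_of_le_of_lt ?_ h)
      exact ENNReal.ofReal_le_ofReal (mul_le_of_le_one_left ht.le hθ.2)
  · have hseg : ∀ s, 0 < s → s ≤ t → x - s • v ∈ Ω := fun s hs hst => by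
      have := h (s / t) ⟨by positivity, (div_le_one ht).2 hst⟩
      rwa [div_mul_cancel₀ s ht.ne'] at this
    have hc : Continuous fun s : ℝ => x - s • v := by fun_prop
    obtain ⟨δ, hδ, hball⟩ := Metric.isOpen_iff.1 (hΩ.preimage hc) t (hseg t ht le_rfl)
    refine lt_of_lt_of_le (b := ENNReal.ofReal (t + δ)) ?_ ?_
    · exact (ENNReal.ofReal_lt_ofReal_iff (by positivity)).2 (by linarith)
    · refine le_iInf₂ fun s hs => ENNReal.ofReal_le_ofReal ?_
      by_contra! hlt
      rcases le_or_gt s t with hst | hst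
      · exact hs.2 (hseg s hs.1 hst)
      · refine hs.2 (hball ?_)
        rw [Metric.mem_ball, Real.dist_eq, abs_lt]
        constructor <;> linarith

/-- The integrand of `resKer` at frequency `η = 0`, cut off to `staySet Ω`. -/
noncomputable def dampedTransport (Ω : Set (EuclideanSpace ℝ (Fin d))) (k : ℕ) (ε : ℝ)
    (f : EuclideanSpace ℝ (Fin d) → EuclideanSpace ℝ (Fin d) → ℂ) :
    (EuclideanSpace ℝ (Fin d) × EuclideanSpace ℝ (Fin d)) × ℝ → ℂ :=
  (staySet Ω).indicator fun q =>
    ((q.2 ^ k * Real.exp (-ε * q.2) : ℝ) : ℂ) * f (q.1.1 - q.2 • q.1.2) q.1.2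

theorem measurable_dampedTransport {Ω : Set (EuclideanSpace ℝ (Fin d))} (hΩ : IsOpen Ω)
    (k : ℕ) (ε : ℝ) {f : EuclideanSpace ℝ (Fin d) → EuclideanSpace ℝ (Fin d) → ℂ}
    (hf : Measurable (Function.uncurry f)) : Measurable (dampedTransport Ω k ε f) := by
  refine Measurable.indicator (Measurable.mul (by fun_prop) ?_) (isOpen_staySet hΩ).measurableSet
  exact hf.comp (g := Function.uncurry f)
    (f := fun q : (EuclideanSpace ℝ (Fin d) × EuclideanSpace ℝ (Fin d)) × ℝ =>
      (q.1.1 - q.2 • q.1.2, q.1.2)) (by fun_prop)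

theorem resKer_eq_integral_fourierChar {Ω : Set (EuclideanSpace ℝ (Fin d))} (hΩ : IsOpen Ω)
    (k : ℕ) (ε η : ℝ) (f : EuclideanSpace ℝ (Fin d) → EuclideanSpace ℝ (Fin d) → ℂ)
    {x : EuclideanSpace ℝ (Fin d)} (hx : x ∈ Ω) (v : EuclideanSpace ℝ (Fin d)) :
    resKer Ω k ε η f x v =
      ∫ t : ℝ, Real.fourierChar (-(t * (η * (2 * Real.pi)⁻¹))) •
        dampedTransport Ω k ε f ((x, v), t) := by
  have hset : {t : ℝ | 0 < t ∧ ENNReal.ofReal t < tminus Ω x v} =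
      (fun t => ((x, v), t)) ⁻¹' staySet Ω :=
    Set.ext fun t => lt_tminus_iff_mem_staySet hΩ hx t
  have hmeas : MeasurableSet ((fun t : ℝ => ((x, v), t)) ⁻¹' staySet Ω) :=
    ((isOpen_staySet hΩ).preimage (by fun_prop)).measurableSet
  rw [resKer, hset, ← integral_indicator hmeas]
  refine integral_congr_ae (Eventually.of_forall fun t => ?_)
  by_cases ht : ((x, v), t) ∈ staySet Ω
  · have ht' : t ∈ (fun t : ℝ => ((x, v), t)) ⁻¹' staySet Ω := ht
    simp only [dampedTransport, indicator_of_mem ht, indicator_of_mem ht', Circle.smul_def,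
      Real.fourierChar_apply, smul_eq_mul]
    have hexp : Complex.exp (-((ε : ℂ) + (η : ℂ) * Complex.I) * (t : ℂ)) =
        Complex.exp (((2 * Real.pi * (-(t * (η * (2 * Real.pi)⁻¹))) : ℝ) : ℂ) * Complex.I) *
          Complex.exp ((-ε * t : ℝ) : ℂ) := by
      rw [← Complex.exp_add]
      congr 1
      have hpi : (2 * Real.pi * (-(t * (η * (2 * Real.pi)⁻¹))) : ℝ) = -(t * η) := by
        have := Real.pi_ne_zero
        field_simp
      rw [hpi]
      push_cast
      ring
    rw [hexp]
    push_cast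
    ring
  · have ht' : t ∉ (fun t : ℝ => ((x, v), t)) ⁻¹' staySet Ω := ht
    simp only [dampedTransport, indicator_of_notMem ht, indicator_of_notMem ht', smul_zero]

theorem Xnorm_zero_eq_lintegral_prod (Ω : Set (EuclideanSpace ℝ (Fin d)))
    (m : Measure (EuclideanSpace ℝ (Fin d))) [SigmaFinite m]
    {g : EuclideanSpace ℝ (Fin d) → EuclideanSpace ℝ (Fin d) → ℂ}
    (hg : Measurable (Function.uncurry g)) :
    Xnorm Ω m 0 g = ∫⁻ p, ‖Function.uncurry g p‖ₑ ∂((volume.restrict Ω).prod m) := by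
  rw [lintegral_prod _ hg.enorm.aemeasurable]
  simp [Xnorm, Function.uncurry, enorm_eq_nnnorm]

theorem Xnorm_zero_congr {Ω : Set (EuclideanSpace ℝ (Fin d))} (hΩ : MeasurableSet Ω)
    (m : Measure (EuclideanSpace ℝ (Fin d)))
    {g h : EuclideanSpace ℝ (Fin d) → EuclideanSpace ℝ (Fin d) → ℂ}
    (hgh : ∀ x ∈ Ω, ∀ v, g x v = h x v) : Xnorm Ω m 0 g = Xnorm Ω m 0 h :=
  setLIntegral_congr_fun hΩ fun x hx => by simp only [hgh x hx]

theorem lintegral_pow_mul_exp_neg_lt_top (k : ℕ) {ε : ℝ} (hε : 0 < ε) :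
    ∫⁻ t in Ioi (0 : ℝ), ENNReal.ofReal (t ^ k * Real.exp (-ε * t)) < ⊤ := by
  have hint : IntegrableOn (fun t : ℝ => t ^ k * Real.exp (-ε * t)) (Ioi 0) := by
    have h := integrableOn_rpow_mul_exp_neg_mul_rpow (s := k) (p := 1) (b := ε)
      (by linarith [(Nat.cast_nonneg k : (0 : ℝ) ≤ k)]) one_pos hε
    simpa only [Real.rpow_natCast, Real.rpow_one] using h
  exact hint.lintegral_lt_top

/-- The free flow over a fixed time `t`, restricted to points that stay in `Ω`, does not increase
the `L¹(Ω × ℝ^d)` norm. -/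
theorem lintegral_enorm_dampedTransport_le {Ω : Set (EuclideanSpace ℝ (Fin d))} (hΩ : IsOpen Ω)
    (m : Measure (EuclideanSpace ℝ (Fin d))) [SigmaFinite m] (k : ℕ) (ε : ℝ)
    {f : EuclideanSpace ℝ (Fin d) → EuclideanSpace ℝ (Fin d) → ℂ}
    (hf : Measurable (Function.uncurry f)) (t : ℝ) :
    ∫⁻ p, ‖dampedTransport Ω k ε f (p, t)‖ₑ ∂((volume.restrict Ω).prod m) ≤
      (Ioi (0 : ℝ)).indicator (fun t => ENNReal.ofReal (t ^ k * Real.exp (-ε * t))) t *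
        ∫⁻ p, ‖Function.uncurry f p‖ₑ ∂((volume.restrict Ω).prod m) := by
  have hD := measurable_dampedTransport hΩ k ε hf
  rw [lintegral_prod_symm (fun p => ‖dampedTransport Ω k ε f (p, t)‖ₑ)
      (hD.comp measurable_prodMk_right).enorm.aemeasurable,
    lintegral_prod_symm _ hf.enorm.aemeasurable,
    ← lintegral_const_mul _ hf.enorm.lintegral_prod_left']
  refine lintegral_mono fun v => ?_
  have hfv : Measurable fun x => ‖f x v‖ₑ := (hf.comp measurable_prodMk_right).enorm
  simp only [Function.uncurry_apply_pair]
  rw [← lintegral_const_mul _ hfv]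
  calc ∫⁻ x in Ω, ‖dampedTransport Ω k ε f ((x, v), t)‖ₑ
      ≤ ∫⁻ x, ‖dampedTransport Ω k ε f ((x, v), t)‖ₑ := setLIntegral_le_lintegral _ _
    _ ≤ ∫⁻ x, Ω.indicator (fun y =>
          (Ioi (0 : ℝ)).indicator (fun t => ENNReal.ofReal (t ^ k * Real.exp (-ε * t))) t *
            ‖f y v‖ₑ) (x - t • v) := by
        refine lintegral_mono fun x => ?_
        by_cases hx : ((x, v), t) ∈ staySet Ω
        · have ht : t ∈ Ioi (0 : ℝ) := hx.1
          have hxt : x - t • v ∈ Ω := by simpa using hx.2 1 (by simp)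
          have hw : 0 ≤ t ^ k * Real.exp (-ε * t) :=
            mul_nonneg (pow_nonneg (le_of_lt ht) _) (Real.exp_pos _).le
          simp only [dampedTransport, indicator_of_mem hx, indicator_of_mem hxt,
            indicator_of_mem ht]
          rw [enorm_mul, ← ofReal_norm ((_ : ℝ) : ℂ), Complex.norm_real,
            Real.norm_of_nonneg hw]
        · simp [dampedTransport, indicator_of_notMem hx]
    _ = ∫⁻ x in Ω,
          (Ioi (0 : ℝ)).indicator (fun t => ENNReal.ofReal (t ^ k * Real.exp (-ε * t))) t *
            ‖f x v‖ₑ := by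
        rw [lintegral_sub_right_eq_self, lintegral_indicator hΩ.measurableSet]

theorem lintegral_lintegral_enorm_dampedTransport_lt_top
    {Ω : Set (EuclideanSpace ℝ (Fin d))} (hΩ : IsOpen Ω)
    (m : Measure (EuclideanSpace ℝ (Fin d))) [SigmaFinite m] (k : ℕ) {ε : ℝ} (hε : 0 < ε)
    {f : EuclideanSpace ℝ (Fin d) → EuclideanSpace ℝ (Fin d) → ℂ}
    (hf : Measurable (Function.uncurry f)) (hfX : Xnorm Ω m 0 f < ⊤) :
    ∫⁻ p, (∫⁻ t, ‖dampedTransport Ω k ε f (p, t)‖ₑ) ∂((volume.restrict Ω).prod m) < ⊤ := by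
  rw [lintegral_lintegral_swap (measurable_dampedTransport hΩ k ε hf).enorm.aemeasurable]
  refine (lintegral_mono fun t => lintegral_enorm_dampedTransport_le hΩ m k ε hf t).trans_lt ?_
  rw [Xnorm_zero_eq_lintegral_prod Ω m hf] at hfX
  rw [lintegral_mul_const' _ _ hfX.ne, lintegral_indicator measurableSet_Ioi]
  exact ENNReal.mul_lt_top (lintegral_pow_mul_exp_neg_lt_top k hε) hfX

end Helpers

/-- For `ε > 0` fixed and `f ∈ X₀`, every `k`-th derivative kernel `D^k_{ε,η} f` belongs
to `X₀`, and its `X₀`-norm tends to `0` as `|η| → ∞`. -/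
theorem resKer_mem_and_riemannLebesgue {d : ℕ} (hd : 1 ≤ d)
    (Ω : Set (EuclideanSpace ℝ (Fin d))) (hΩopen : IsOpen Ω)
    (hΩne : Ω.Nonempty) (hΩbdd : Bornology.IsBounded Ω)
    (m : Measure (EuclideanSpace ℝ (Fin d))) [SigmaFinite m] (hm0 : m {0} = 0)
    (ε : ℝ) (hε : 0 < ε) (k : ℕ)
    (f : EuclideanSpace ℝ (Fin d) → EuclideanSpace ℝ (Fin d) → ℂ)
    (hf : Measurable (Function.uncurry f))
    (hfX : Xnorm Ω m 0 f < ⊤) :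
    (∀ η : ℝ, Xnorm Ω m 0 (resKer Ω k ε η f) < ⊤) ∧
    Filter.Tendsto (fun η : ℝ => Xnorm Ω m 0 (resKer Ω k ε η f))
      (Filter.cocompact ℝ) (nhds 0) := by
  set μ := (volume.restrict Ω).prod m
  set F := dampedTransport Ω k ε f
  have hF : Measurable F := measurable_dampedTransport hΩopen k ε hf
  let H : ℝ → EuclideanSpace ℝ (Fin d) × EuclideanSpace ℝ (Fin d) → ℂ := fun η p =>
    ∫ t : ℝ, Real.fourierChar (-(t * (η * (2 * Real.pi)⁻¹))) • F (p, t)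
  have hH : ∀ η, Measurable (H η) := fun η => by
    have hchar : Measurable fun q : (EuclideanSpace ℝ (Fin d) × EuclideanSpace ℝ (Fin d)) × ℝ =>
        (Real.fourierChar (-(q.2 * (η * (2 * Real.pi)⁻¹))) : ℂ) :=
      (continuous_subtype_val.comp (Real.continuous_fourierChar.comp (by fun_prop))).measurable
    exact ((hchar.mul hF).stronglyMeasurable.integral_prod_right' (ν := volume)).measurable
  have hX : ∀ η, Xnorm Ω m 0 (resKer Ω k ε η f) = ∫⁻ p, ‖H η p‖ₑ ∂μ := fun η => by
    rw [Xnorm_zero_congr hΩopen.measurableSet m (h := Function.curry (H η))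
      fun x hx v => resKer_eq_integral_fourierChar hΩopen k ε η f hx v]
    exact Xnorm_zero_eq_lintegral_prod Ω m (hH η)
  have hbound : ∀ η p, ‖H η p‖ₑ ≤ ∫⁻ t, ‖F (p, t)‖ₑ := fun η p => by
    refine (enorm_integral_le_lintegral_enorm _).trans_eq (lintegral_congr fun t => ?_)
    rw [← ofReal_norm, ← ofReal_norm, Circle.norm_smul]
  have hfin : ∫⁻ p, (∫⁻ t, ‖F (p, t)‖ₑ) ∂μ < ⊤ :=
    lintegral_lintegral_enorm_dampedTransport_lt_top hΩopen m k hε hf hfX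
  simp only [hX]
  refine ⟨fun η => (lintegral_mono (hbound η)).trans_lt hfin, ?_⟩
  have hscale : Tendsto (fun η : ℝ => η * (2 * Real.pi)⁻¹) (cocompact ℝ) (cocompact ℝ) :=
    (Homeomorph.mulRight₀ (2 * Real.pi)⁻¹
      (inv_ne_zero (by positivity))).isClosedEmbedding.tendsto_cocompact
  have hpt : ∀ p, Tendsto (fun η => ‖H η p‖ₑ) (cocompact ℝ) (𝓝 0) := fun p => by
    have h := ((Real.tendsto_integral_exp_smul_cocompact fun t => F (p, t)).comp hscale).enorm
    rwa [enorm_zero] at h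
  have : (cocompact ℝ).IsCountablyGenerated := by
    rw [cocompact_eq_atBot_atTop]
    infer_instance
  simpa only [lintegral_zero] using tendsto_lintegral_filter_of_dominated_convergence
    (fun p => ∫⁻ t, ‖F (p, t)‖ₑ) (Eventually.of_forall fun η => (hH η).enorm)
    (Eventually.of_forall fun η => Eventually.of_forall (hbound η)) hfin.ne
    (Eventually.of_forall hpt)
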